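/- Let (𝒫, ℒ) and (𝒫′, ℒ′) be linear spaces with dim(𝒫, ℒ) ≥ 3 and dim(𝒫′, ℒ′) ≥ 3, and let φ : ℒ → ℒ′ be a bijection such that a ∼ b if and only if φ(a) ∼′ φ(b) for all a, b ∈ ℒ. If φ maps some star of lines of (𝒫, ℒ) onto a coplanar maximal related set of (𝒫′, ℒ′), then the map δ : 𝒫 → 𝒫′*, sending, for adjacent lines a, b ∈ ℒ, the unique point of a ∩ b to the plane φ(a) ∨ φ(b) of (𝒫′, ℒ′), is a well-defined collineation of (𝒫, ℒ) onto the dual linear space (𝒫′*, ℒ′*) of (𝒫′, ℒ′). -/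

import Mathlib

/-- A linear space: a point set `P` together with a set of lines (subsets of `P`),
each line having at least two points, and any two distinct points lying on
exactly one line. -/
structure LinearSpace (P : Type*) where
  lines : Set (Set P)
  two_points : ∀ l ∈ lines, ∃ A B : P, A ≠ B ∧ A ∈ l ∧ B ∈ l
  unique_line : ∀ A B : P, A ≠ B → ∃! l, l ∈ lines ∧ A ∈ l ∧ B ∈ l

namespace LinearSpace

variable {P : Type*} (LS : LinearSpace P)

/-- A subspace: a subset containing, with any two of its distinct points,
the line joining them. -/
def IsSubspace (S : Set P) : Prop :=
  ∀ l ∈ LS.lines, ∀ A ∈ l, ∀ B ∈ l, A ≠ B → A ∈ S → B ∈ S → l ⊆ S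

/-- The span of a subset: the intersection of all subspaces containing it. -/
def span (S : Set P) : Set P :=
  ⋂₀ {T | LS.IsSubspace T ∧ S ⊆ T}

/-- The dimension of a subset `S` (intended for subspaces):
`min {#X - 1 | X ⊆ S, span X = S}` as an extended natural number. -/
noncomputable def sdim (S : Set P) : ℕ∞ :=
  sInf {d : ℕ∞ | ∃ X : Set P, X ⊆ S ∧ LS.span X = S ∧ d = X.encard - 1}

/-- The dimension of the linear space: `min {#X - 1 | span X = P}`. -/
noncomputable def dim : ℕ∞ := LS.sdim Set.univ

/-- A plane is a 2-dimensional subspace. -/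
def IsPlane (E : Set P) : Prop := LS.IsSubspace E ∧ LS.sdim E = 2

/-- A generalized projective space: every plane is a generalized projective
plane, i.e. any two distinct lines contained in a common plane meet. -/
def IsGenProjSpace : Prop :=
  ∀ E : Set P, LS.IsPlane E →
    ∀ l ∈ LS.lines, ∀ m ∈ LS.lines, l ⊆ E → m ⊆ E → l ≠ m → (l ∩ m).Nonempty

/-- A related set: a set of lines which pairwise meet. -/
def IsRelatedSet (N : Set (Set P)) : Prop :=
  N ⊆ LS.lines ∧ ∀ a ∈ N, ∀ b ∈ N, (a ∩ b).Nonempty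

/-- A maximal related set: a related set maximal with respect to inclusion. -/
def IsMaxRelatedSet (M : Set (Set P)) : Prop :=
  LS.IsRelatedSet M ∧ ∀ N, LS.IsRelatedSet N → M ⊆ N → N = M

/-- The star of lines with vertex `A`: all lines through `A`. -/
def star (A : P) : Set (Set P) := {l | l ∈ LS.lines ∧ A ∈ l}

/-- The pencil of planes with axis `a`: all planes containing `a`. -/
def pencil (a : Set P) : Set (Set P) := {E | LS.IsPlane E ∧ a ⊆ E}

/-- A collineation: a bijection of the point sets mapping each line onto a
line, and whose inverse does likewise. -/
def IsCollineation {P' : Type*} (LS' : LinearSpace P') (κ : P → P') : Prop :=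
  Function.Bijective κ ∧ (∀ l ∈ LS.lines, κ '' l ∈ LS'.lines) ∧
    (∀ l' ∈ LS'.lines, κ ⁻¹' l' ∈ LS.lines)

end LinearSpace

namespace LinearSpace

section Basic

variable {P : Type*} {LS : LinearSpace P}

theorem eq_of_mem {l m : Set P} (hl : l ∈ LS.lines) (hm : m ∈ LS.lines) {A B : P} (h : A ≠ B)
    (hAl : A ∈ l) (hBl : B ∈ l) (hAm : A ∈ m) (hBm : B ∈ m) : l = m :=
  (LS.unique_line A B h).unique ⟨hl, hAl, hBl⟩ ⟨hm, hAm, hBm⟩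

theorem point_eq_of_mem {l m : Set P} (hl : l ∈ LS.lines) (hm : m ∈ LS.lines) (h : l ≠ m) {A B : P}
    (hAl : A ∈ l) (hBl : B ∈ l) (hAm : A ∈ m) (hBm : B ∈ m) : A = B := by
  by_contra hne
  exact h (eq_of_mem hl hm hne hAl hBl hAm hBm)

theorem exists_line {A B : P} (h : A ≠ B) : ∃ l ∈ LS.lines, A ∈ l ∧ B ∈ l :=
  (LS.unique_line A B h).exists

theorem exists_mem_ne {l : Set P} (hl : l ∈ LS.lines) (A : P) : ∃ B ∈ l, B ≠ A := by
  obtain ⟨B, C, hne, hB, hC⟩ := LS.two_points l hl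
  by_cases h : B = A
  · exact ⟨C, hC, fun h' => hne (h.trans h'.symm)⟩
  · exact ⟨B, hB, h⟩

theorem subset_span (S : Set P) : S ⊆ LS.span S :=
  Set.subset_sInter fun _ hT => hT.2

theorem span_subset {S T : Set P} (hT : LS.IsSubspace T) (h : S ⊆ T) : LS.span S ⊆ T :=
  Set.sInter_subset_of_mem ⟨hT, h⟩

theorem isSubspace_span (S : Set P) : LS.IsSubspace (LS.span S) := by
  intro l hl A hA B hB hne hAS hBS X hX T hT
  exact hT.1 l hl A hA B hB hne (hAS T hT) (hBS T hT) hX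

theorem isSubspace_line {l : Set P} (hl : l ∈ LS.lines) : LS.IsSubspace l := by
  intro m hm A hA B hB hne hAl hBl
  exact (eq_of_mem hm hl hne hA hB hAl hBl).subset

theorem IsSubspace.line_subset {S : Set P} (hS : LS.IsSubspace S) {l : Set P} (hl : l ∈ LS.lines)
    {A B : P} (hne : A ≠ B) (hA : A ∈ l) (hB : B ∈ l) (hAS : A ∈ S) (hBS : B ∈ S) : l ⊆ S :=
  hS l hl A hA B hB hne hAS hBS

theorem encard_triple_sub_one_le (A B C : P) : ({A, B, C} : Set P).encard - 1 ≤ 2 := by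
  have hpair : ({B, C} : Set P).encard ≤ 2 := by
    simpa [one_add_one_eq_two] using Set.encard_insert_le {C} B
  have h : ({A, B, C} : Set P).encard ≤ 2 + 1 :=
    (Set.encard_insert_le _ _).trans (by gcongr)
  exact tsub_le_iff_right.2 h

theorem exists_notMem_span (hdim : 3 ≤ LS.dim) (A B C : P) : ∃ X, X ∉ LS.span {A, B, C} := by
  by_contra! h
  have h1 : LS.dim ≤ ({A, B, C} : Set P).encard - 1 :=
    sInf_le ⟨{A, B, C}, Set.subset_univ _, Set.eq_univ_of_forall h, rfl⟩
  exact absurd (hdim.trans (h1.trans (encard_triple_sub_one_le A B C))) (by decide)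

/-- In dimension at least three, the span of a point and a line misses some line through
the point. -/
theorem exists_line_notMem_span_insert (hdim : 3 ≤ LS.dim) (A : P) {m : Set P}
    (hm : m ∈ LS.lines) :
    ∃ l ∈ LS.lines, A ∈ l ∧ ¬ l ⊆ LS.span (insert A m) := by
  obtain ⟨B, C, hne, hB, hC⟩ := LS.two_points m hm
  obtain ⟨X, hX⟩ := exists_notMem_span hdim A B C
  have hAX : A ≠ X := by
    rintro rfl
    exact hX (subset_span _ (by simp))
  obtain ⟨l, hl, hAl, hXl⟩ := LS.exists_line hAX
  refine ⟨l, hl, hAl, fun hsub => hX ?_⟩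
  refine span_subset (isSubspace_span _) ?_ (hsub hXl)
  refine Set.insert_subset (subset_span _ (by simp)) ?_
  exact (isSubspace_span _).line_subset hm hne hB hC (subset_span _ (by simp))
    (subset_span _ (by simp))

/-- In dimension at least three, a line meeting all lines through a point passes through it. -/
theorem mem_of_forall_inter_nonempty (hdim : 3 ≤ LS.dim) {A : P} {m : Set P} (hm : m ∈ LS.lines)
    (h : ∀ l ∈ LS.lines, A ∈ l → (l ∩ m).Nonempty) : A ∈ m := by
  by_contra hA
  obtain ⟨l, hl, hAl, hsub⟩ := exists_line_notMem_span_insert hdim A hm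
  obtain ⟨B, hBl, hBm⟩ := h l hl hAl
  have hne : A ≠ B := fun h => hA (h ▸ hBm)
  exact hsub ((isSubspace_span _).line_subset hl hne hAl hBl (subset_span _ (Set.mem_insert _ _))
    (subset_span _ (Set.mem_insert_of_mem _ hBm)))

theorem isPlane_span_union {l m : Set P} (hl : l ∈ LS.lines) (hm : m ∈ LS.lines) (hne : l ≠ m)
    {A : P} (hAl : A ∈ l) (hAm : A ∈ m) : LS.IsPlane (LS.span (l ∪ m)) := by
  refine ⟨isSubspace_span _, le_antisymm ?_ (le_sInf ?_)⟩
  · obtain ⟨B, hB, hBA⟩ := exists_mem_ne hl A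
    obtain ⟨C, hC, hCA⟩ := exists_mem_ne hm A
    have hsub : ({A, B, C} : Set P) ⊆ LS.span (l ∪ m) := by
      rintro X (rfl | rfl | rfl)
      · exact subset_span _ (Or.inl hAl)
      · exact subset_span _ (Or.inl hB)
      · exact subset_span _ (Or.inr hC)
    have hspan : LS.span {A, B, C} = LS.span (l ∪ m) := by
      refine (span_subset (isSubspace_span _) hsub).antisymm
        (span_subset (isSubspace_span _) (Set.union_subset ?_ ?_))
      · exact (isSubspace_span _).line_subset hl hBA.symm hAl hB (subset_span _ (by simp))
          (subset_span _ (by simp))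
      · exact (isSubspace_span _).line_subset hm hCA.symm hAm hC (subset_span _ (by simp))
          (subset_span _ (by simp))
    have h1 : LS.sdim (LS.span (l ∪ m)) ≤ ({A, B, C} : Set P).encard - 1 :=
      sInf_le ⟨_, hsub, hspan, rfl⟩
    exact h1.trans (encard_triple_sub_one_le A B C)
  · rintro _ ⟨X, -, hspan, rfl⟩
    by_contra! hlt
    have key : ∀ k ∈ LS.lines, ¬ X ⊆ k := by
      intro k hk hX
      have hsub : l ∪ m ⊆ k := (subset_span _).trans (hspan ▸ span_subset (isSubspace_line hk) hX)
      obtain ⟨B, hB, hBA⟩ := exists_mem_ne hl A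
      obtain ⟨C, hC, hCA⟩ := exists_mem_ne hm A
      apply hne
      rw [eq_of_mem hl hk hBA.symm hAl hB (hsub (Or.inl hAl)) (hsub (Or.inl hB)),
        eq_of_mem hm hk hCA.symm hAm hC (hsub (Or.inl hAl)) (hsub (Or.inr hC))]
    have hpair : ∃ B C : P, B ≠ C ∧ X ⊆ {B, C} := by
      have h2 : X.encard ≤ 2 := by
        have : X.encard - 1 ≤ 1 := Order.le_of_lt_add_one (by simpa [one_add_one_eq_two] using hlt)
        simpa [one_add_one_eq_two] using tsub_le_iff_right.1 this
      rcases h2.lt_or_eq with h | h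
      · have h1 : X.encard ≤ 1 := Order.le_of_lt_add_one (by simpa [one_add_one_eq_two] using h)
        obtain ⟨B, C, hBC, -, -⟩ := LS.two_points l hl
        rcases Set.encard_le_one_iff_eq.1 h1 with rfl | ⟨D, rfl⟩
        · exact ⟨B, C, hBC, Set.empty_subset _⟩
        · obtain ⟨E, -, hE⟩ := exists_mem_ne hl D
          exact ⟨D, E, hE.symm, by simp⟩
      · obtain ⟨B, C, hBC, rfl⟩ := Set.encard_eq_two.1 h
        exact ⟨B, C, hBC, subset_rfl⟩
    obtain ⟨B, C, hBC, hX⟩ := hpair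
    obtain ⟨k, hk, hB, hC⟩ := LS.exists_line hBC
    exact key k hk (hX.trans (by rintro _ (rfl | rfl) <;> assumption))

/-- Every plane is spanned by two distinct lines with a common point. -/
theorem IsPlane.exists_eq_span_union {E : Set P} (hE : LS.IsPlane E) :
    ∃ l ∈ LS.lines, ∃ m ∈ LS.lines, l ≠ m ∧ (l ∩ m).Nonempty ∧ LS.span (l ∪ m) = E := by
  obtain ⟨hsub, hdim⟩ := hE
  have hne : {d : ℕ∞ | ∃ X : Set P, X ⊆ E ∧ LS.span X = E ∧ d = X.encard - 1}.Nonempty := by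
    by_contra h
    rw [sdim, Set.not_nonempty_iff_eq_empty.1 h, sInf_empty] at hdim
    exact absurd hdim (by decide)
  obtain ⟨X, hXE, hspan, hcard⟩ := csInf_mem hne
  have hcard : X.encard - 1 = 2 := hcard.symm.trans hdim
  have h3 : X.encard = 3 := by
    generalize X.encard = n at hcard
    cases n with
    | top => exact absurd hcard (by decide)
    | coe n =>
      have : n - 1 = 2 := by exact_mod_cast hcard
      have : n = 3 := by omega
      rw [this]; rfl
  obtain ⟨A, B, C, hAB, hAC, hBC, rfl⟩ := Set.encard_eq_three.1 h3
  have hA : A ∈ E := hXE (by simp)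
  have hB : B ∈ E := hXE (by simp)
  have hC : C ∈ E := hXE (by simp)
  obtain ⟨l, hl, hAl, hBl⟩ := LS.exists_line hAB
  obtain ⟨m, hm, hAm, hCm⟩ := LS.exists_line hAC
  refine ⟨l, hl, m, hm, ?_, ⟨A, hAl, hAm⟩, ?_⟩
  · rintro rfl
    have hEl : E ⊆ l := hspan ▸ span_subset (isSubspace_line hl)
      (by rintro _ (rfl | rfl | rfl) <;> assumption)
    have hpair : LS.span {A, B} = E := by
      refine (span_subset hsub (by rintro _ (rfl | rfl) <;> assumption)).antisymm (hEl.trans ?_)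
      exact (isSubspace_span _).line_subset hl hAB hAl hBl (subset_span _ (by simp))
        (subset_span _ (by simp))
    have h1 : LS.sdim E ≤ ({A, B} : Set P).encard - 1 :=
      sInf_le ⟨_, by rintro _ (rfl | rfl) <;> assumption, hpair, rfl⟩
    rw [hdim, Set.encard_pair hAB] at h1
    exact absurd h1 (by decide)
  · refine (span_subset hsub (Set.union_subset (hsub.line_subset hl hAB hAl hBl hA hB)
      (hsub.line_subset hm hAC hAm hCm hA hC))).antisymm ?_
    rw [← hspan]
    refine span_subset (isSubspace_span _) ?_
    rintro _ (rfl | rfl | rfl)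
    · exact subset_span _ (Or.inl hAl)
    · exact subset_span _ (Or.inl hBl)
    · exact subset_span _ (Or.inr hCm)

end Basic

section LineMap

variable {P P' : Type*} {LS : LinearSpace P} {LS' : LinearSpace P'} {φ : Set P → Set P'}

/-- The union of the images of the lines through a point. -/
def starImage (LS : LinearSpace P) (φ : Set P → Set P') (X : P) : Set P' :=
  {Z | ∃ a ∈ LS.lines, X ∈ a ∧ Z ∈ φ a}

theorem exists_mem_image_of_image_star_ne (hdim' : 3 ≤ LS'.dim)
    (hbij : Set.BijOn φ LS.lines LS'.lines)
    (hrel : ∀ a ∈ LS.lines, ∀ b ∈ LS.lines, ((a ∩ b).Nonempty ↔ (φ a ∩ φ b).Nonempty))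
    {X : P} (hX : ∀ A' : P', φ '' LS.star X ≠ LS'.star A') (V : P') :
    ∃ r ∈ LS.lines, X ∉ r ∧ V ∈ φ r := by
  by_contra! h
  refine hX V (Set.Subset.antisymm ?_ ?_)
  · rintro _ ⟨a, ⟨ha, hXa⟩, rfl⟩
    refine ⟨hbij.mapsTo ha, mem_of_forall_inter_nonempty hdim' (hbij.mapsTo ha) ?_⟩
    intro l' hl' hV
    obtain ⟨l, hl, rfl⟩ := hbij.surjOn hl'
    have hXl : X ∈ l := by
      by_contra hXl
      exact h l hl hXl hV
    exact (hrel l hl a ha).1 ⟨X, hXl, hXa⟩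
  · rintro l' ⟨hl', hV⟩
    obtain ⟨l, hl, rfl⟩ := hbij.surjOn hl'
    refine ⟨l, ⟨hl, ?_⟩, rfl⟩
    by_contra hXl
    exact h l hl hXl hV

theorem exists_notMem_image_of_image_star_ne (hdim : 3 ≤ LS.dim)
    (hbij : Set.BijOn φ LS.lines LS'.lines)
    (hrel : ∀ a ∈ LS.lines, ∀ b ∈ LS.lines, ((a ∩ b).Nonempty ↔ (φ a ∩ φ b).Nonempty))
    {X : P} (hX : ∀ A' : P', φ '' LS.star X ≠ LS'.star A') (V : P') :
    ∃ r ∈ LS.lines, X ∈ r ∧ V ∉ φ r := by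
  by_contra! h
  refine hX V (Set.Subset.antisymm ?_ ?_)
  · rintro _ ⟨a, ⟨ha, hXa⟩, rfl⟩
    exact ⟨hbij.mapsTo ha, h a ha hXa⟩
  · rintro l' ⟨hl', hV⟩
    obtain ⟨l, hl, rfl⟩ := hbij.surjOn hl'
    refine ⟨l, ⟨hl, mem_of_forall_inter_nonempty hdim hl fun a ha hXa => ?_⟩, rfl⟩
    exact (hrel a ha l hl).2 ⟨V, h a ha hXa, hV⟩

/-- If the image of the star of `X` is not a star, then a line whose image joins two points of
the union of this image passes through `X`. -/
theorem mem_of_mem_starImage (hdim : 3 ≤ LS.dim) (hdim' : 3 ≤ LS'.dim)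
    (hbij : Set.BijOn φ LS.lines LS'.lines)
    (hrel : ∀ a ∈ LS.lines, ∀ b ∈ LS.lines, ((a ∩ b).Nonempty ↔ (φ a ∩ φ b).Nonempty))
    {X : P} (hX : ∀ A' : P', φ '' LS.star X ≠ LS'.star A') {z : Set P} (hz : z ∈ LS.lines)
    {A B : P'} (hAB : A ≠ B) (hAz : A ∈ φ z) (hBz : B ∈ φ z)
    (hA : A ∈ LS.starImage φ X) (hB : B ∈ LS.starImage φ X) : X ∈ z := by
  by_contra hXz
  obtain ⟨f, hf, hXf, hAf⟩ := hA
  obtain ⟨g, hg, hXg, hBg⟩ := hB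
  have hφ : ∀ {a}, a ∈ LS.lines → φ a ∈ LS'.lines := fun ha => hbij.mapsTo ha
  have hF : LS.IsSubspace (LS.span (insert X z)) := isSubspace_span _
  have hXF : X ∈ LS.span (insert X z) := subset_span _ (Set.mem_insert _ _)
  have hzF : z ⊆ LS.span (insert X z) := (Set.subset_insert _ _).trans (subset_span _)
  have hsub : ∀ a ∈ LS.lines, X ∈ a → (a ∩ z).Nonempty → a ⊆ LS.span (insert X z) := by
    rintro a ha hXa ⟨Y, hYa, hYz⟩
    exact hF.line_subset ha (fun h : X = Y => hXz (h ▸ hYz)) hXa hYa hXF (hzF hYz)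
  obtain ⟨d, hd, hXd, hdF⟩ := exists_line_notMem_span_insert hdim X hz
  have hdz : ¬ (φ d ∩ φ z).Nonempty := fun h => hdF (hsub d hd hXd ((hrel d hd z hz).2 h))
  have hdF' : ∀ Y ∈ d, Y ∈ LS.span (insert X z) → Y = X := by
    intro Y hY hYF
    by_contra hne
    exact hdF (hF.line_subset hd hne hY hXd hYF hXF)
  have hfF := hsub f hf hXf ((hrel f hf z hz).2 ⟨A, hAf, hAz⟩)
  have hgF := hsub g hg hXg ((hrel g hg z hz).2 ⟨B, hBg, hBz⟩)
  have hBf : B ∉ φ f := by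
    intro hBf
    have := hbij.injOn hf hz (eq_of_mem (hφ hf) (hφ hz) hAB hAf hBf hAz hBz)
    exact hXz (this ▸ hXf)
  have hfg : f ≠ g := fun h => hBf (h ▸ hBg)
  obtain ⟨V, hVd, hVf⟩ := (hrel d hd f hf).1 ⟨X, hXd, hXf⟩
  have hVB : V ≠ B := by
    rintro rfl
    exact hBf hVf
  obtain ⟨w', hw', hVw, hBw⟩ := LS'.exists_line hVB
  obtain ⟨w, hw, rfl⟩ := hbij.surjOn hw'
  have hwf : w ≠ f := by
    rintro rfl
    exact hBf hBw
  have hXw : X ∈ w := by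
    by_contra hXw
    obtain ⟨D, hDw, hDd⟩ := (hrel w hw d hd).2 ⟨V, hVw, hVd⟩
    obtain ⟨Q, hQw, hQf⟩ := (hrel w hw f hf).2 ⟨V, hVw, hVf⟩
    obtain ⟨R, hRw, hRg⟩ := (hrel w hw g hg).2 ⟨B, hBw, hBg⟩
    have hQR : Q ≠ R := by
      rintro rfl
      exact hXw (point_eq_of_mem hf hg hfg hQf hXf hRg hXg ▸ hQw)
    have hwF := hF.line_subset hw hQR hQw hRw (hfF hQf) (hgF hRg)
    exact hXw (hdF' D hDd (hwF hDw) ▸ hDw)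
  have hwF := hsub w hw hXw ((hrel w hw z hz).2 ⟨B, hBw, hBz⟩)
  obtain ⟨r, hr, hXr, hVr⟩ := exists_mem_image_of_image_star_ne hdim' hbij hrel hX V
  obtain ⟨Q, hQr, hQf⟩ := (hrel r hr f hf).2 ⟨V, hVr, hVf⟩
  obtain ⟨R, hRr, hRw⟩ := (hrel r hr w hw).2 ⟨V, hVr, hVw⟩
  obtain ⟨D, hDr, hDd⟩ := (hrel r hr d hd).2 ⟨V, hVr, hVd⟩
  have hQR : Q ≠ R := by
    rintro rfl
    exact hXr (point_eq_of_mem hw hf hwf hRw hXw hQf hXf ▸ hQr)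
  have hrF := hF.line_subset hr hQR hQr hRr (hfF hQf) (hwF hRw)
  exact hXr (hdF' D hDd (hrF hDr) ▸ hDr)

theorem isSubspace_starImage (hdim : 3 ≤ LS.dim) (hdim' : 3 ≤ LS'.dim)
    (hbij : Set.BijOn φ LS.lines LS'.lines)
    (hrel : ∀ a ∈ LS.lines, ∀ b ∈ LS.lines, ((a ∩ b).Nonempty ↔ (φ a ∩ φ b).Nonempty))
    {X : P} (hX : ∀ A' : P', φ '' LS.star X ≠ LS'.star A') :
    LS'.IsSubspace (LS.starImage φ X) := by
  intro l' hl' A hA B hB hne hAS hBS Y hY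
  obtain ⟨l, hl, rfl⟩ := hbij.surjOn hl'
  exact ⟨l, hl, mem_of_mem_starImage hdim hdim' hbij hrel hX hl hne hA hB hAS hBS, hY⟩

theorem image_subset_starImage_iff (hdim : 3 ≤ LS.dim) (hdim' : 3 ≤ LS'.dim)
    (hbij : Set.BijOn φ LS.lines LS'.lines)
    (hrel : ∀ a ∈ LS.lines, ∀ b ∈ LS.lines, ((a ∩ b).Nonempty ↔ (φ a ∩ φ b).Nonempty))
    {X : P} (hX : ∀ A' : P', φ '' LS.star X ≠ LS'.star A') {a : Set P} (ha : a ∈ LS.lines) :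
    φ a ⊆ LS.starImage φ X ↔ X ∈ a := by
  refine ⟨fun h => ?_, fun hXa Z hZ => ⟨a, ha, hXa, hZ⟩⟩
  obtain ⟨A, B, hne, hA, hB⟩ := LS'.two_points _ (hbij.mapsTo ha)
  exact mem_of_mem_starImage hdim hdim' hbij hrel hX ha hne hA hB (h hA) (h hB)

theorem starImage_eq_span (hdim : 3 ≤ LS.dim) (hdim' : 3 ≤ LS'.dim)
    (hbij : Set.BijOn φ LS.lines LS'.lines)
    (hrel : ∀ a ∈ LS.lines, ∀ b ∈ LS.lines, ((a ∩ b).Nonempty ↔ (φ a ∩ φ b).Nonempty))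
    {X : P} (hX : ∀ A' : P', φ '' LS.star X ≠ LS'.star A') {a b : Set P} (ha : a ∈ LS.lines)
    (hb : b ∈ LS.lines) (hab : a ≠ b) (hXa : X ∈ a) (hXb : X ∈ b) :
    LS.starImage φ X = LS'.span (φ a ∪ φ b) := by
  refine Set.Subset.antisymm ?_ (span_subset (isSubspace_starImage hdim hdim' hbij hrel hX)
    (Set.union_subset (fun Z hZ => ⟨a, ha, hXa, hZ⟩) fun Z hZ => ⟨b, hb, hXb, hZ⟩))
  have hφ : ∀ {a}, a ∈ LS.lines → φ a ∈ LS'.lines := fun ha => hbij.mapsTo ha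
  have hφab : φ a ≠ φ b := fun h => hab (hbij.injOn ha hb h)
  have hS : LS'.IsSubspace (LS'.span (φ a ∪ φ b)) := isSubspace_span _
  have haS : φ a ⊆ LS'.span (φ a ∪ φ b) := Set.subset_union_left.trans (subset_span _)
  have hbS : φ b ⊆ LS'.span (φ a ∪ φ b) := Set.subset_union_right.trans (subset_span _)
  obtain ⟨U, hUa, hUb⟩ := (hrel a ha b hb).1 ⟨X, hXa, hXb⟩
  have hoff : ∀ d ∈ LS.lines, X ∈ d → U ∉ φ d → φ d ⊆ LS'.span (φ a ∪ φ b) := by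
    intro d hd hXd hUd
    obtain ⟨Q, hQd, hQa⟩ := (hrel d hd a ha).1 ⟨X, hXd, hXa⟩
    obtain ⟨R, hRd, hRb⟩ := (hrel d hd b hb).1 ⟨X, hXd, hXb⟩
    have hQR : Q ≠ R := by
      rintro rfl
      exact hUd (point_eq_of_mem (hφ ha) (hφ hb) hφab hQa hUa hRb hUb ▸ hQd)
    exact hS.line_subset (hφ hd) hQR hQd hRd (haS hQa) (hbS hRb)
  obtain ⟨c, hc, hXc, hUc⟩ := exists_notMem_image_of_image_star_ne hdim hbij hrel hX U
  rintro Z ⟨d, hd, hXd, hZ⟩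
  by_cases hUd : U ∈ φ d
  · obtain ⟨Q, hQd, hQc⟩ := (hrel d hd c hc).1 ⟨X, hXd, hXc⟩
    exact hS.line_subset (hφ hd) (fun h : U = Q => hUc (h ▸ hQc)) hUd hQd (haS hUa)
      (hoff c hc hXc hUc hQc) hZ
  · exact hoff d hd hXd hUd hZ

theorem image_star_ne_of_image_star_ne (hdim : 3 ≤ LS.dim) (hdim' : 3 ≤ LS'.dim)
    (hbij : Set.BijOn φ LS.lines LS'.lines)
    (hrel : ∀ a ∈ LS.lines, ∀ b ∈ LS.lines, ((a ∩ b).Nonempty ↔ (φ a ∩ φ b).Nonempty))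
    {A : P} (hA : ∀ A' : P', φ '' LS.star A ≠ LS'.star A') (B : P) (B' : P') :
    φ '' LS.star B ≠ LS'.star B' := by
  intro h
  have hBA : A ≠ B := by
    rintro rfl
    exact hA B' h
  obtain ⟨l, hl, hAl, hBl⟩ := LS.exists_line hBA
  have hB'l : B' ∈ φ l := (h.subset ⟨l, ⟨hl, hBl⟩, rfl⟩).2
  obtain ⟨r, hr, hAr, hB'r⟩ := exists_notMem_image_of_image_star_ne hdim hbij hrel hA B'
  obtain ⟨U, hUl, hUr⟩ := (hrel l hl r hr).1 ⟨A, hAl, hAr⟩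
  obtain ⟨Q, hQr, hQU⟩ := exists_mem_ne (hbij.mapsTo hr) U
  have hQl : Q ∉ φ l := by
    intro hQl
    have := eq_of_mem (hbij.mapsTo hr) (hbij.mapsTo hl) hQU hQr hUr hQl hUl
    exact hB'r (this ▸ hB'l)
  have hB'Q : B' ≠ Q := fun h => hQl (h ▸ hB'l)
  obtain ⟨k', hk', hB'k, hQk⟩ := LS'.exists_line hB'Q
  obtain ⟨k, ⟨hk, hBk⟩, rfl⟩ := h.superset ⟨hk', hB'k⟩
  have hAk : A ∈ k := mem_of_mem_starImage hdim hdim' hbij hrel hA hk hB'Q hB'k hQk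
    ⟨l, hl, hAl, hB'l⟩ ⟨r, hr, hAr, hQr⟩
  exact hQl (eq_of_mem hk hl hBA hAk hBk hAl hBl ▸ hQk)

end LineMap

end LinearSpace

/-- If a relatedness-preserving line bijection `φ` (both directions, dimensions
at least 3) maps some star of lines onto a coplanar maximal related set, then
the map `δ` sending, for adjacent lines `a, b`, the point `a ∩ b` to the plane
`φ a ∨ φ b` is a well-defined collineation of `(P, L)` onto the dual linear
space of `(P', L')`: it is a bijection of `P` onto the set of planes of
`(P', L')` mapping lines onto pencils of planes, and conversely. -/
theorem dual_collineation_of_star_to_coplanar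
    {P P' : Type*} (LS : LinearSpace P) (LS' : LinearSpace P')
    (hdim : 3 ≤ LS.dim) (hdim' : 3 ≤ LS'.dim)
    (φ : Set P → Set P') (hbij : Set.BijOn φ LS.lines LS'.lines)
    (hrel : ∀ a ∈ LS.lines, ∀ b ∈ LS.lines,
      ((a ∩ b).Nonempty ↔ (φ a ∩ φ b).Nonempty))
    (hstar : ∃ A : P, LS'.IsMaxRelatedSet (φ '' LS.star A) ∧
      ∀ A' : P', φ '' LS.star A ≠ LS'.star A') :
    ∃ δ : P → Set P',
      (∀ a ∈ LS.lines, ∀ b ∈ LS.lines, a ≠ b →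
        ∀ X : P, X ∈ a → X ∈ b → δ X = LS'.span (φ a ∪ φ b)) ∧
      Function.Injective δ ∧
      Set.range δ = {E : Set P' | LS'.IsPlane E} ∧
      (∀ l ∈ LS.lines, ∃ a' ∈ LS'.lines, δ '' l = LS'.pencil a') ∧
      (∀ a' ∈ LS'.lines, ∃ l ∈ LS.lines, δ '' l = LS'.pencil a') := by
  obtain ⟨A, -, hA⟩ := hstar
  have hns : ∀ X : P, ∀ A' : P', φ '' LS.star X ≠ LS'.star A' :=
    LinearSpace.image_star_ne_of_image_star_ne hdim hdim' hbij hrel hA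
  have hmem : ∀ X : P, ∀ a ∈ LS.lines, (φ a ⊆ LS.starImage φ X ↔ X ∈ a) := fun X _ ha =>
    LinearSpace.image_subset_starImage_iff hdim hdim' hbij hrel (hns X) ha
  have hspan : ∀ a ∈ LS.lines, ∀ b ∈ LS.lines, a ≠ b → ∀ X : P, X ∈ a → X ∈ b →
      LS.starImage φ X = LS'.span (φ a ∪ φ b) := fun _ ha _ hb hab X hXa hXb =>
    LinearSpace.starImage_eq_span hdim hdim' hbij hrel (hns X) ha hb hab hXa hXb
  have havoid : ∀ X : P, ∀ l ∈ LS.lines, ∃ r ∈ LS.lines, X ∈ r ∧ l ≠ r := by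
    intro X l hl
    obtain ⟨V, -, -, hV, -⟩ := LS'.two_points _ (hbij.mapsTo hl)
    obtain ⟨r, hr, hXr, hVr⟩ :=
      LinearSpace.exists_notMem_image_of_image_star_ne hdim hbij hrel (hns X) V
    exact ⟨r, hr, hXr, fun h => hVr (h ▸ hV)⟩
  have hplane : ∀ X : P, LS'.IsPlane (LS.starImage φ X) := by
    intro X
    obtain ⟨Y, hY⟩ := LinearSpace.exists_notMem_span hdim X X X
    have hXY : X ≠ Y := fun h => hY (LinearSpace.subset_span _ (by simp [h]))
    obtain ⟨l, hl, hXl, -⟩ := LS.exists_line hXY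
    obtain ⟨r, hr, hXr, hne⟩ := havoid X l hl
    obtain ⟨U, hUl, hUr⟩ := (hrel l hl r hr).1 ⟨X, hXl, hXr⟩
    rw [hspan l hl r hr hne X hXl hXr]
    exact LinearSpace.isPlane_span_union (hbij.mapsTo hl) (hbij.mapsTo hr)
      (fun h => hne (hbij.injOn hl hr h)) hUl hUr
  have hsurj : ∀ E, LS'.IsPlane E → ∃ X, LS.starImage φ X = E := by
    intro E hE
    obtain ⟨l', hl', m', hm', hne, hmeet, rfl⟩ := hE.exists_eq_span_union
    obtain ⟨l, hl, rfl⟩ := hbij.surjOn hl'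
    obtain ⟨m, hm, rfl⟩ := hbij.surjOn hm'
    obtain ⟨X, hXl, hXm⟩ := (hrel l hl m hm).2 hmeet
    exact ⟨X, hspan l hl m hm (fun h => hne (h ▸ rfl)) X hXl hXm⟩
  have hpencil : ∀ l ∈ LS.lines, LS.starImage φ '' l = LS'.pencil (φ l) := by
    intro l hl
    ext E
    constructor
    · rintro ⟨X, hX, rfl⟩
      exact ⟨hplane X, (hmem X l hl).2 hX⟩
    · rintro ⟨hE, hlE⟩
      obtain ⟨X, rfl⟩ := hsurj E hE
      exact ⟨X, (hmem X l hl).1 hlE, rfl⟩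
  refine ⟨LS.starImage φ, hspan, ?_, ?_, ?_, ?_⟩
  · intro X Y hXY
    by_contra hne
    obtain ⟨l, hl, hXl, hYl⟩ := LS.exists_line hne
    obtain ⟨r, hr, hXr, hlr⟩ := havoid X l hl
    have hYr : Y ∈ r := (hmem Y r hr).1 (hXY ▸ (hmem X r hr).2 hXr)
    exact hlr (LinearSpace.eq_of_mem hl hr hne hXl hYl hXr hYr)
  · ext E
    exact ⟨by rintro ⟨X, rfl⟩; exact hplane X, hsurj E⟩
  · exact fun l hl => ⟨φ l, hbij.mapsTo hl, hpencil l hl⟩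
  · intro a' ha'
    obtain ⟨l, hl, rfl⟩ := hbij.surjOn ha'
    exact ⟨l, hl, hpencil l hl⟩
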